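/- Let G be a finite abelian group with |G| ≥ 3. Then every point x ∈ C(G) has all coordinates nonnegative: x(a) ≥ 0 for every a ∈ G. -/

import Mathlib

/-- The group cone `C(G)`: functions `x : G → ℝ` with `x 0 = 0` and
`x a + x b ≥ x (a + b)` for all nonzero `a b` with `a + b ≠ 0`. -/
def InGroupCone {G : Type*} [AddCommGroup G] (x : G → ℝ) : Prop :=
  x 0 = 0 ∧ ∀ a b : G, a ≠ 0 → b ≠ 0 → a + b ≠ 0 → x (a + b) ≤ x a + x b

theorem stmt4_aux {G : Type*} [AddCommGroup G] [Fintype G]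
    (x : G → ℝ) (hx : InGroupCone x) (a : G) (ha : a ≠ 0) :
    x (-a) ≤ ((Fintype.card G : ℝ) - 1) * x a := by
  classical
  obtain ⟨h0, h⟩ := hx
  have key : ∀ b ∈ (Finset.univ : Finset G),
      x (a + b) ≤ x a + x b - (if b = -a then x a + x (-a) else 0) := by
    intro b _
    by_cases hb : b = -a
    · subst hb
      simp [h0]
    · rw [if_neg hb, sub_zero]
      by_cases hb0 : b = 0
      · subst hb0
        simp [h0]
      · exact h a b ha hb0 (fun e => hb (eq_neg_of_add_eq_zero_right e))
  have hs := Finset.sum_le_sum key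
  rw [Finset.sum_sub_distrib, Finset.sum_add_distrib, Finset.sum_ite_eq' Finset.univ (-a),
    if_pos (Finset.mem_univ _), Finset.sum_const, Finset.card_univ, nsmul_eq_mul] at hs
  have e : ∑ b : G, x (a + b) = ∑ b : G, x b :=
    Equiv.sum_comp (Equiv.addLeft a) x
  rw [e] at hs
  linarith

theorem stmt4 {G : Type*} [AddCommGroup G] [Fintype G]
    (hG : 3 ≤ Fintype.card G) (x : G → ℝ) (hx : InGroupCone x) :
    ∀ a : G, 0 ≤ x a := by
  intro a
  by_cases ha : a = 0
  · rw [ha, hx.1]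
  have h1 := stmt4_aux x hx a ha
  have h2 := stmt4_aux x hx (-a) (neg_ne_zero.mpr ha)
  rw [neg_neg] at h2
  have hn : (3 : ℝ) ≤ (Fintype.card G : ℝ) := by exact_mod_cast hG
  by_contra hneg
  push Not at hneg
  have h3 : x (-a) < x a := by nlinarith
  have h4 : x a < x (-a) := by nlinarith
  linarith
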